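/- arXiv:1305.6239 — 2 statements merged into one kernel-verified Lean document; each statement's English description precedes it below -/
import Mathlib

section
/- Fix d ≥ 1, a compact set χ ⊂ ℝ^d and positive constants α, C_a, C_b, δ_a, ε₀, f_max, and let 𝓕(α) be the set of Lebesgue probability densities on χ satisfying assumptions [A] and [B] with these constants. Then there is a constant C > 0, depending only on d, α, C_a, C_b, δ_a, ε₀ and f_max, such that for every n ≥ 2 and every f ∈ 𝓕(α), if X₁,…,Xₙ are i.i.d. with density f and X̂ₙ = {X₁,…,Xₙ}, then 𝔼[ d_H(X_f, X̂ₙ) ] ≤ C (log n / n)^{1/(d+α)}, where X_f is the support of the measure f·λ. -/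
open MeasureTheory Metric

/-- The `ε`-inner set of a set `G`: the union of all open balls of radius `ε` entirely
contained in `G`. -/
def innerSet {E : Type*} [MetricSpace E] (ε : ℝ) (G : Set E) : Set E :=
  ⋃ x ∈ {x : E | ball x ε ⊆ G}, ball x ε

/-- The support of a Borel measure on a metric space: the points all of whose open balls
have positive measure (in `ℝ^d` this is the smallest closed set of full measure). -/
def msupp {M : Type*} [MetricSpace M] [MeasurableSpace M] (μ : Measure M) : Set M :=
  {x : M | ∀ r : ℝ, 0 < r → 0 < μ (ball x r)}

/-- The class `𝓕(α)`: Lebesgue probability densities supported in `χ` satisfying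
assumptions `[A]` and `[B]` with constants `α, C_a, C_b, δ_a, ε₀, f_max`. -/
def FclassAB {d : ℕ} (χ : Set (EuclideanSpace ℝ (Fin d)))
    (α Ca Cb δa ε₀ fmax : ℝ) (f : EuclideanSpace ℝ (Fin d) → ℝ) : Prop :=
  Measurable f ∧ (∀ x, 0 ≤ f x) ∧ (∫ x, f x = 1) ∧ (∀ x, x ∉ χ → f x = 0) ∧
  (∀ x, f x ≤ fmax) ∧
  (∀ x ∈ {y | 0 < f y}, f x ≤ δa →
    Ca * infDist x (frontier {y | 0 < f y}) ^ α ≤ f x) ∧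
  (∀ ε : ℝ, 0 < ε → ε ≤ ε₀ →
    (innerSet ε {y | 0 < f y}).Nonempty ∧
    ∀ x ∈ frontier {y | 0 < f y},
      infDist x (innerSet ε {y | 0 < f y}) ≤ Cb * ε)


lemma exists_finset_net_of_le_measure_ball {M : Type*} [MetricSpace M] [MeasurableSpace M]
    [OpensMeasurableSpace M] (μ : Measure M) [IsProbabilityMeasure μ] (A : Set M) {ρ q : ℝ}
    (hq : 0 < q) (hρ : 0 < ρ) (hball : ∀ x ∈ A, q ≤ μ.real (ball x ρ)) :
    ∃ S : Finset M, ↑S ⊆ A ∧ S.card * q ≤ 1 ∧ ∀ x ∈ A, ∃ s ∈ S, dist x s < 2 * ρ := by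
  classical
  let P : Finset M → Prop := fun S =>
    ↑S ⊆ A ∧ (S : Set M).Pairwise fun x y => 2 * ρ ≤ dist x y
  have hcard : ∀ S, P S → S.card * q ≤ 1 := by
    intro S hS
    have hdisj : (S : Set M).PairwiseDisjoint fun x => ball x ρ := fun x hx y hy hxy =>
      ball_disjoint_ball (by linarith [hS.2 hx hy hxy])
    calc S.card * q = ∑ _s ∈ S, q := by simp
      _ ≤ ∑ s ∈ S, μ.real (ball s ρ) := Finset.sum_le_sum fun s hs => hball s (hS.1 hs)
      _ = μ.real (⋃ s ∈ S, ball s ρ) :=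
        (measureReal_biUnion_finset hdisj fun _ _ => measurableSet_ball).symm
      _ ≤ 1 := measureReal_le_one
  have hbdd : BddAbove (Set.image Finset.card {S | P S}) := by
    refine ⟨⌈1 / q⌉₊, ?_⟩
    rintro _ ⟨S, hS, rfl⟩
    have := (le_div_iff₀ hq).2 (hcard S hS)
    exact_mod_cast this.trans (Nat.le_ceil _)
  obtain ⟨S, hS, hmax⟩ :=
    Nat.sSup_mem (s := Set.image Finset.card {S | P S}) ⟨0, ∅, by simp [P], rfl⟩ hbdd
  refine ⟨S, hS.1, hcard S hS, fun x hx => ?_⟩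
  by_contra! hfar
  have hxS : x ∉ S := fun h => by
    have := hfar x h
    rw [dist_self] at this
    linarith
  have hins : P (insert x S) := by
    refine ⟨?_, ?_⟩
    · rw [Finset.coe_insert]
      exact Set.insert_subset hx hS.1
    · rw [Finset.coe_insert]
      refine hS.2.insert fun y hy _ => ⟨hfar y hy, ?_⟩
      rw [dist_comm]
      exact hfar y hy
  have := le_csSup hbdd ⟨_, hins, rfl⟩
  rw [← hmax, Finset.card_insert_of_notMem hxS] at this
  omega

lemma hausdorffDist_range_le_of_forall_dist_le {M ι : Type*} [MetricSpace M] [Nonempty ι]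
    {A : Set M} {D : ℝ} (hD : ∀ x ∈ A, ∀ y ∈ A, dist x y ≤ D) {ω : ι → M} (hω : ∀ i, ω i ∈ A) :
    hausdorffDist A (Set.range ω) ≤ D := by
  obtain ⟨i⟩ := ‹Nonempty ι›
  refine hausdorffDist_le_of_mem_dist (dist_nonneg.trans (hD _ (hω i) _ (hω i)))
    (fun x hx => ⟨ω i, ⟨i, rfl⟩, hD _ hx _ (hω i)⟩) ?_
  rintro _ ⟨j, rfl⟩
  exact ⟨ω i, hω i, hD _ (hω j) _ (hω i)⟩

lemma ae_pi_forall_mem {M ι : Type*} [Fintype ι] [MeasurableSpace M] (μ : Measure M)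
    [SigmaFinite μ] {A : Set M} (hA : ∀ᵐ x ∂μ, x ∈ A) :
    ∀ᵐ ω ∂(Measure.pi fun _ : ι => μ), ∀ i, ω i ∈ A := by
  rw [ae_all_iff]
  intro i
  exact (Measure.quasiMeasurePreserving_eval (fun _ : ι => μ) i).ae hA

lemma measureReal_pi_forall_notMem_le {M ι : Type*} [Fintype ι] [MeasurableSpace M]
    (μ : Measure M) [IsProbabilityMeasure μ] {B : Set M} (hB : MeasurableSet B) {q : ℝ}
    (hq : q ≤ μ.real B) :
    (Measure.pi fun _ : ι => μ).real {ω | ∀ i, ω i ∉ B} ≤ Real.exp (-(Fintype.card ι * q)) := by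
  have hset : {ω : ι → M | ∀ i, ω i ∉ B} = Set.univ.pi fun _ => Bᶜ := by
    ext ω
    simp [Set.mem_pi]
  have h1 : (Measure.pi fun _ : ι => μ).real {ω | ∀ i, ω i ∉ B}
      = (1 - μ.real B) ^ Fintype.card ι := by
    rw [hset, measureReal_def, Measure.pi_pi, Finset.prod_const, ENNReal.toReal_pow,
      ← measureReal_def, probReal_compl_eq_one_sub hB, Finset.card_univ]
  rw [h1, ← mul_neg, Real.exp_nat_mul]
  refine pow_le_pow_left₀ (sub_nonneg.2 measureReal_le_one) ?_ _
  linarith [Real.one_sub_le_exp_neg q]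

lemma lintegral_hausdorffDist_range_le {M ι : Type*} [Fintype ι] [Nonempty ι] [MetricSpace M]
    [MeasurableSpace M] [OpensMeasurableSpace M] (μ : Measure M) [IsProbabilityMeasure μ]
    {A : Set M} (hA : ∀ᵐ x ∂μ, x ∈ A) {D : ℝ} (hD0 : 0 ≤ D)
    (hD : ∀ x ∈ A, ∀ y ∈ A, dist x y ≤ D) {ρ q : ℝ} (hρ : 0 < ρ) (hq : 0 < q)
    (hball : ∀ x ∈ A, q ≤ μ.real (ball x ρ)) :
    ∫⁻ ω, ENNReal.ofReal (hausdorffDist A (Set.range ω)) ∂(Measure.pi fun _ : ι => μ)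
      ≤ ENNReal.ofReal (4 * ρ + D * (1 / q * Real.exp (-(Fintype.card ι * q)))) := by
  obtain ⟨S, hSA, hcard, hS⟩ := exists_finset_net_of_le_measure_ball μ A hq hρ hball
  set Q := Measure.pi fun _ : ι => μ
  let Bad : Set (ι → M) := ⋃ s ∈ S, {ω | ∀ i, ω i ∉ ball s (2 * ρ)}
  have hBadm : MeasurableSet Bad := by
    refine S.measurableSet_biUnion fun s _ => ?_
    rw [Set.ofPred_forall]
    exact MeasurableSet.iInter fun i => (measurable_pi_apply i) measurableSet_ball.compl
  have hBad : Q.real Bad ≤ 1 / q * Real.exp (-(Fintype.card ι * q)) := by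
    calc Q.real Bad ≤ ∑ s ∈ S, Q.real {ω | ∀ i, ω i ∉ ball s (2 * ρ)} :=
          measureReal_biUnion_finset_le _ _
      _ ≤ ∑ _s ∈ S, Real.exp (-(Fintype.card ι * q)) := by
          refine Finset.sum_le_sum fun s hs => ?_
          refine measureReal_pi_forall_notMem_le μ measurableSet_ball ((hball s (hSA hs)).trans ?_)
          exact measureReal_mono (ball_subset_ball (by linarith))
      _ = S.card * Real.exp (-(Fintype.card ι * q)) := by simp
      _ ≤ _ := by
          gcongr
          exact (le_div_iff₀ hq).2 hcard
  calc ∫⁻ ω, ENNReal.ofReal (hausdorffDist A (Set.range ω)) ∂Q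
      ≤ ∫⁻ ω, (ENNReal.ofReal (4 * ρ) + Bad.indicator (fun _ => ENNReal.ofReal D) ω) ∂Q := by
        refine lintegral_mono_ae ?_
        filter_upwards [ae_pi_forall_mem (ι := ι) μ hA] with ω hω
        by_cases hb : ω ∈ Bad
        · rw [Set.indicator_of_mem hb]
          exact (ENNReal.ofReal_le_ofReal
            (hausdorffDist_range_le_of_forall_dist_le hD hω)).trans le_add_self
        · rw [Set.indicator_of_notMem hb, add_zero]
          refine ENNReal.ofReal_le_ofReal (hausdorffDist_le_of_mem_dist (by positivity) ?_ ?_)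
          · intro x hx
            obtain ⟨s, hs, hxs⟩ := hS x hx
            simp only [Bad, Set.mem_iUnion, Set.mem_ofPred_eq, not_exists, not_forall,
              not_not, mem_ball] at hb
            obtain ⟨i, hi⟩ := hb s hs
            exact ⟨ω i, ⟨i, rfl⟩, by linarith [dist_triangle_right x (ω i) s]⟩
          · rintro _ ⟨i, rfl⟩
            exact ⟨ω i, hω i, by rw [dist_self]; positivity⟩
    _ = ENNReal.ofReal (4 * ρ) + ENNReal.ofReal D * Q Bad := by
        rw [lintegral_add_left measurable_const, lintegral_const, measure_univ, mul_one,
          lintegral_indicator_const hBadm]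
    _ = ENNReal.ofReal (4 * ρ + D * Q.real Bad) := by
        rw [ENNReal.ofReal_add (by positivity) (by positivity), ENNReal.ofReal_mul hD0,
          ofReal_measureReal (measure_ne_top Q Bad)]
    _ ≤ _ := by
        refine ENNReal.ofReal_le_ofReal ?_
        gcongr

lemma exists_mem_ball_frontier_of_not_ball_subset {E : Type*} [NormedAddCommGroup E]
    [NormedSpace ℝ E] {G : Set E} {x : E} {r : ℝ} (hr : 0 < r) (hx : x ∈ closure G)
    (h : ¬ ball x r ⊆ G) : ∃ y ∈ frontier G, dist y x < r := by
  by_contra! hfar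
  have hint : ∀ y ∈ ball x r, y ∈ closure G → y ∈ interior G := fun y hy hyG => by
    by_contra hyi
    exact absurd (mem_ball.1 hy) (hfar y ⟨hyG, hyi⟩).not_gt
  obtain ⟨z, hz, hzG⟩ := Set.not_subset.1 h
  obtain ⟨y, -, hyi, hyc⟩ := (convex_ball x r).isPreconnected (interior G) (closure G)ᶜ
    isOpen_interior isClosed_closure.isOpen_compl
    (fun y hy => (em (y ∈ closure G)).imp (hint y hy) id)
    ⟨x, mem_ball_self hr, hint x (mem_ball_self hr) hx⟩
    ⟨z, hz, fun hzc => hzG (interior_subset (hint z hz hzc))⟩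
  exact hyc (interior_subset_closure hyi)

/-- Around a point of `closure G`, any ball contains a ball of comparable radius inside `G`. -/
lemma exists_ball_subset_of_mem_closure {E : Type*} [NormedAddCommGroup E] [NormedSpace ℝ E]
    {G : Set E} {Cb r ε : ℝ} (hCb : 0 < Cb) (hε : 0 < ε) (hr : 2 * (Cb + 3) * ε ≤ r)
    (hne : (innerSet ε G).Nonempty)
    (hinner : ∀ x ∈ frontier G, infDist x (innerSet ε G) ≤ Cb * ε) {x : E} (hx : x ∈ closure G) :
    ∃ w, ball w ε ⊆ G ∧ ball w ε ⊆ ball x r := by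
  have hεr : 6 * ε ≤ r := by nlinarith [mul_pos hCb hε]
  by_cases h : ball x (r / 2) ⊆ G
  · exact ⟨x, (ball_subset_ball (by linarith)).trans h, ball_subset_ball (by linarith)⟩
  obtain ⟨y, hy, hyx⟩ := exists_mem_ball_frontier_of_not_ball_subset (by linarith) hx h
  obtain ⟨z, hz, hyz⟩ := (infDist_lt_iff hne).1 ((hinner y hy).trans_lt
    (show Cb * ε < (Cb + 1) * ε by linarith))
  simp only [innerSet, Set.mem_iUnion, Set.mem_ofPred_eq] at hz
  obtain ⟨w, hwG, hzw⟩ := hz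
  refine ⟨w, hwG, ball_subset_ball' ?_⟩
  rw [mem_ball] at hzw
  have := dist_triangle4 w z y x
  rw [dist_comm w z, dist_comm z y] at this
  nlinarith

lemma half_le_infDist_frontier {E : Type*} [PseudoMetricSpace E] {G : Set E} {w z : E} {ε : ℝ}
    (hne : (frontier G).Nonempty) (hw : ball w ε ⊆ G) (hz : z ∈ ball w (ε / 2)) :
    ε / 2 ≤ infDist z (frontier G) := by
  refine (le_infDist hne).2 fun y hy => ?_
  by_contra! hlt
  have hyw : y ∈ ball w ε := by
    rw [mem_ball] at hz ⊢
    linarith [dist_triangle y z w, dist_comm y z]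
  exact hy.2 (interior_maximal hw isOpen_ball hyw)

lemma isProbabilityMeasure_withDensity_ofReal {X : Type*} [MeasurableSpace X] {ν : Measure X}
    {f : X → ℝ} (hf : ∀ x, 0 ≤ f x) (h1 : ∫ x, f x ∂ν = 1) :
    IsProbabilityMeasure (ν.withDensity fun x => ENNReal.ofReal (f x)) := by
  have hint : Integrable f ν := by
    by_contra h
    simp [integral_undef h] at h1
  refine ⟨?_⟩
  rw [withDensity_apply _ MeasurableSet.univ, Measure.restrict_univ,
    ← ofReal_integral_eq_lintegral_ofReal hint (ae_of_all _ hf), h1, ENNReal.ofReal_one]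

lemma msupp_withDensity_subset_closure {X : Type*} [MetricSpace X] [MeasurableSpace X]
    [OpensMeasurableSpace X] (ν : Measure X) (f : X → ℝ) :
    msupp (ν.withDensity fun x => ENNReal.ofReal (f x)) ⊆ closure {y | 0 < f y} := by
  intro x hx
  by_contra hxc
  obtain ⟨r, hr, hball⟩ := Metric.isOpen_iff.1 isClosed_closure.isOpen_compl x hxc
  refine (hx r hr).ne' ?_
  rw [withDensity_apply _ measurableSet_ball]
  refine setLIntegral_eq_zero measurableSet_ball fun y hy => ?_
  exact ENNReal.ofReal_eq_zero.2 (not_lt.1 fun h => hball hy (subset_closure h))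

lemma ae_withDensity_ofReal_pos {X : Type*} [MeasurableSpace X] (ν : Measure X) {f : X → ℝ}
    (hf : Measurable f) :
    ∀ᵐ x ∂(ν.withDensity fun x => ENNReal.ofReal (f x)), 0 < f x := by
  rw [ae_withDensity_iff hf.ennreal_ofReal]
  refine ae_of_all _ fun x hx => ?_
  exact ENNReal.ofReal_pos.1 (pos_iff_ne_zero.2 hx)

section SmallBalls

variable {d : ℕ} {χ : Set (EuclideanSpace ℝ (Fin d))} {α Ca Cb δa ε₀ fmax : ℝ}
  {f : EuclideanSpace ℝ (Fin d) → ℝ}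

lemma frontier_pos_nonempty (hd : 1 ≤ d) (hχ : IsCompact χ)
    (hint : ∫ x, f x = 1) (hf0 : ∀ x, 0 ≤ f x) (hsupp : ∀ x, x ∉ χ → f x = 0) :
    (frontier {y | 0 < f y}).Nonempty := by
  have : Nonempty (Fin d) := ⟨⟨0, hd⟩⟩
  rw [nonempty_frontier_iff]
  constructor
  · by_contra hempty
    rw [Set.not_nonempty_iff_eq_empty] at hempty
    have hzero : ∀ x, f x = 0 := fun x =>
      le_antisymm (not_lt.1 fun h => (hempty ▸ h : x ∈ (∅ : Set _))) (hf0 x)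
    simp [hzero] at hint
  · intro huniv
    refine hχ.ne_univ (Set.eq_univ_of_forall fun x => ?_)
    by_contra hx
    have hpos : x ∈ {y | 0 < f y} := huniv ▸ Set.mem_univ x
    exact absurd (hsupp x hx) (ne_of_gt hpos)

/-- Lower bound on the mass of small balls centred at the support of a density in the class. -/
lemma FclassAB.le_measureReal_ball (hd : 1 ≤ d) (hχ : IsCompact χ)
    (hα : 0 < α) (hCa : 0 < Ca) (hCb : 0 < Cb) (hδa : 0 < δa)
    (hf : FclassAB χ α Ca Cb δa ε₀ fmax f) {r : ℝ} (hr : 0 < r) (hr₀ : r ≤ min ε₀ 2)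
    {x : EuclideanSpace ℝ (Fin d)} (hx : x ∈ closure {y | 0 < f y}) :
    min δa Ca * (1 / (4 * (Cb + 3))) ^ (d + α) *
        (volume : Measure (EuclideanSpace ℝ (Fin d))).real (ball 0 1) * r ^ (d + α)
      ≤ (volume.withDensity fun x => ENNReal.ofReal (f x)).real (ball x r) := by
  obtain ⟨-, hf0, hint, hsupp, -, hA, hB⟩ := hf
  have := isProbabilityMeasure_withDensity_ofReal hf0 hint
  have hfr := frontier_pos_nonempty hd hχ hint hf0 hsupp
  have : Nonempty (Fin d) := ⟨⟨0, hd⟩⟩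
  set G := {y | 0 < f y}
  set μ := volume.withDensity fun x => ENNReal.ofReal (f x)
  set η := 1 / (4 * (Cb + 3)) * r with hη
  have hη0 : 0 < η := by positivity
  have hηr : 4 * (Cb + 3) * η = r := by
    rw [hη]
    field_simp
  have hη12 : 12 * η ≤ r := by nlinarith [mul_pos hCb hη0]
  have hr1 : r ≤ ε₀ := hr₀.trans (min_le_left _ _)
  have hr2 : r ≤ 2 := hr₀.trans (min_le_right _ _)
  obtain ⟨hne, hinner⟩ := hB (2 * η) (by positivity) (by linarith)
  obtain ⟨w, hwG, hwx⟩ := exists_ball_subset_of_mem_closure (r := r) hCb (by positivity)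
    (by linarith) hne hinner hx
  have hlow : ∀ z ∈ ball w η, min δa Ca * η ^ α ≤ f z := by
    intro z hz
    have hηα : η ^ α ≤ 1 := Real.rpow_le_one hη0.le (by linarith) hα.le
    have hηα0 : 0 < η ^ α := Real.rpow_pos_of_pos hη0 α
    have hzG : z ∈ G := hwG (ball_subset_ball (by linarith) hz)
    rcases le_total (f z) δa with h | h
    · have hdist : η ≤ infDist z (frontier G) := by
        have := half_le_infDist_frontier hfr hwG (z := z)
          (by rwa [mul_div_cancel_left₀ _ two_ne_zero])
        linarith
      calc min δa Ca * η ^ α ≤ Ca * infDist z (frontier G) ^ α := by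
            gcongr
            exact min_le_right _ _
        _ ≤ f z := hA z hzG h
    · calc min δa Ca * η ^ α ≤ δa * 1 := by
            gcongr
            exact min_le_left _ _
        _ ≤ f z := by linarith
  have hm : 0 < min δa Ca := lt_min hδa hCa
  have hmeas : ENNReal.ofReal (min δa Ca * η ^ α) * volume (ball w η) ≤ μ (ball x r) := by
    calc ENNReal.ofReal (min δa Ca * η ^ α) * volume (ball w η)
        ≤ ∫⁻ z in ball w η, ENNReal.ofReal (f z) := by
          rw [← setLIntegral_const]
          exact setLIntegral_mono' measurableSet_ball fun z hz =>
            ENNReal.ofReal_le_ofReal (hlow z hz)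
      _ = μ (ball w η) := (withDensity_apply _ measurableSet_ball).symm
      _ ≤ μ (ball x r) :=
          measure_mono ((ball_subset_ball (by linarith)).trans hwx)
  have hreal := ENNReal.toReal_mono (measure_ne_top μ _) hmeas
  rw [ENNReal.toReal_mul, ENNReal.toReal_ofReal (by positivity), Measure.addHaar_ball _ _ hη0.le,
    ENNReal.toReal_mul, ENNReal.toReal_ofReal (by positivity), finrank_euclideanSpace_fin] at hreal
  calc _ = min δa Ca * η ^ (d + α) *
        (volume : Measure (EuclideanSpace ℝ (Fin d))).real (ball 0 1) := by
        rw [hη, Real.mul_rpow (by positivity) hr.le]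
        ring
    _ = min δa Ca * η ^ α *
        (η ^ d * (volume : Measure (EuclideanSpace ℝ (Fin d))).real (ball 0 1)) := by
        rw [Real.rpow_add hη0, Real.rpow_natCast]
        ring
    _ ≤ _ := hreal

end SmallBalls

lemma one_div_mul_exp_le_rpow {n : ℕ} (hn : 2 ≤ n) {β : ℝ} (hβ : 1 ≤ β) :
    1 / (2 * (Real.log n / n)) * Real.exp (-(n * (2 * (Real.log n / n))))
      ≤ 2 * (Real.log n / n) ^ (1 / β) := by
  have hn2 : (2 : ℝ) ≤ n := by exact_mod_cast hn
  have hn0 : (0 : ℝ) < n := by linarith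
  have hlog : 1 / 2 ≤ Real.log n :=
    (by linarith [Real.log_two_gt_d9] : (1 : ℝ) / 2 ≤ Real.log 2).trans
      (Real.log_le_log two_pos hn2)
  have hL1 : Real.log n / n ≤ 1 := by
    rw [div_le_one hn0]
    linarith [Real.log_le_sub_one_of_pos hn0]
  have hL0 : 0 < Real.log n / n := by positivity
  have hexp : Real.exp (-(n * (2 * (Real.log n / n)))) = 1 / (n * n) := by
    rw [show n * (2 * (Real.log n / n)) = Real.log n + Real.log n by field_simp; ring,
      Real.exp_neg, Real.exp_add, Real.exp_log hn0, one_div]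
  calc _ = 1 / (2 * Real.log n ^ 2) * (Real.log n / n) := by
        rw [hexp]
        field_simp
    _ ≤ 2 * (Real.log n / n) := by
        gcongr
        rw [div_le_iff₀ (by positivity)]
        nlinarith
    _ ≤ 2 * (Real.log n / n) ^ (1 / β) := by
        gcongr
        exact Real.self_le_rpow_of_le_one hL0.le hL1 ((div_le_one (by linarith)).2 hβ)

/-- Fix `d ≥ 1`, a compact `χ ⊂ ℝ^d` and positive constants
`α, C_a, C_b, δ_a, ε₀, f_max`. There is a constant `C > 0` such that for every `n ≥ 2`
and every `f ∈ 𝓕(α)`, if `X₁,…,Xₙ` are i.i.d. with density `f` (product measure of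
`μ_f = f·λ`) and `X̂ₙ = {X₁,…,Xₙ}`, then
`𝔼[d_H(X_f, X̂ₙ)] ≤ C (log n / n)^{1/(d+α)}`, where `X_f` is the support of `f·λ`. -/
theorem stmt_12 {d : ℕ} (hd : 1 ≤ d)
    (χ : Set (EuclideanSpace ℝ (Fin d))) (hχ : IsCompact χ)
    (α Ca Cb δa ε₀ fmax : ℝ) (hα : 0 < α) (hCa : 0 < Ca) (hCb : 0 < Cb)
    (hδa : 0 < δa) (hε₀ : 0 < ε₀) (hfmax : 0 < fmax) :
    ∃ C : ℝ, 0 < C ∧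
      ∀ n : ℕ, 2 ≤ n → ∀ f : EuclideanSpace ℝ (Fin d) → ℝ,
        FclassAB χ α Ca Cb δa ε₀ fmax f →
        ∫⁻ ω, ENNReal.ofReal
            (hausdorffDist
              (msupp (volume.withDensity fun x => ENNReal.ofReal (f x)))
              (Set.range ω))
          ∂(Measure.pi fun _ : Fin n =>
              volume.withDensity fun x => ENNReal.ofReal (f x))
          ≤ ENNReal.ofReal (C * (Real.log n / n) ^ ((1 : ℝ) / (d + α))) := by
  have : Nonempty (Fin d) := ⟨⟨0, hd⟩⟩
  have hβ : 1 ≤ (d : ℝ) + α := by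
    have : (1 : ℝ) ≤ d := by exact_mod_cast hd
    linarith
  set c := min δa Ca * (1 / (4 * (Cb + 3))) ^ (d + α) *
    (volume : Measure (EuclideanSpace ℝ (Fin d))).real (ball 0 1)
  have hc : 0 < c := by
    have hv : 0 < (volume : Measure (EuclideanSpace ℝ (Fin d))).real (ball 0 1) :=
      ENNReal.toReal_pos (measure_ball_pos _ _ one_pos).ne' measure_ball_lt_top.ne
    have := lt_min hδa hCa
    positivity
  set B := (2 / c) ^ (1 / (d + α))
  have hB : 0 < B := by positivity
  set r₀ := min ε₀ 2
  have hr₀ : 0 < r₀ := lt_min hε₀ two_pos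
  have hD : 0 ≤ diam χ := diam_nonneg
  refine ⟨4 * B + 2 * diam χ + diam χ * B / r₀, by positivity, fun n hn f hf => ?_⟩
  have : Nonempty (Fin n) := ⟨⟨0, by omega⟩⟩
  have hball := fun (r : ℝ) (hr : 0 < r) (hr' : r ≤ r₀) x hx =>
    hf.le_measureReal_ball hd hχ hα hCa hCb hδa hr hr' (x := x) hx
  obtain ⟨hmeas, hf0, hint, hsupp, -⟩ := hf
  have := isProbabilityMeasure_withDensity_ofReal hf0 hint
  have hsub : closure {y | 0 < f y} ⊆ χ :=
    closure_minimal (fun x hx => not_not.1 fun h => (ne_of_gt hx) (hsupp x h)) hχ.isClosed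
  have hms : msupp (volume.withDensity fun x => ENNReal.ofReal (f x)) = closure {y | 0 < f y} := by
    refine (msupp_withDensity_subset_closure _ _).antisymm fun x hx r hr => ?_
    have hr' : 0 < min r r₀ := lt_min hr hr₀
    have h := hball _ hr' (min_le_right _ _) x hx
    have h0 : 0 < c * min r r₀ ^ (d + α) := by positivity
    exact (ENNReal.toReal_pos_iff.1 (h0.trans_le h)).1.trans_le
      (measure_mono (ball_subset_ball (min_le_left _ _)))
  have hae : ∀ᵐ x ∂(volume.withDensity fun x => ENNReal.ofReal (f x)),
      x ∈ closure {y | 0 < f y} :=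
    (ae_withDensity_ofReal_pos _ hmeas).mono fun x hx => subset_closure hx
  have hdiam : ∀ x ∈ closure {y | 0 < f y}, ∀ y ∈ closure {y | 0 < f y}, dist x y ≤ diam χ :=
    fun x hx y hy => dist_le_diam_of_mem hχ.isBounded (hsub hx) (hsub hy)
  rw [hms]
  have hn1 : (1 : ℝ) < n := by exact_mod_cast hn
  have hL0 : 0 < Real.log n / n := div_pos (Real.log_pos hn1) (by linarith)
  set L := (Real.log n / n) ^ ((1 : ℝ) / (d + α)) with hL
  have hLpos : 0 < L := Real.rpow_pos_of_pos hL0 _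
  rcases le_or_gt (B * L) r₀ with h | h
  · have hq : c * (B * L) ^ (d + α) = 2 * (Real.log n / n) := by
      rw [Real.mul_rpow hB.le hLpos.le, ← Real.rpow_mul (by positivity), hL,
        ← Real.rpow_mul hL0.le, one_div_mul_cancel (by positivity), Real.rpow_one, Real.rpow_one]
      field_simp
    refine (lintegral_hausdorffDist_range_le (ι := Fin n) _ hae hD hdiam
      (ρ := B * L) (q := 2 * (Real.log n / n)) (by positivity) (by positivity)
      (hq ▸ hball _ (by positivity) h)).trans (ENNReal.ofReal_le_ofReal ?_)
    rw [Fintype.card_fin]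
    calc _ ≤ 4 * (B * L) + diam χ * (2 * L) :=
          add_le_add le_rfl (mul_le_mul_of_nonneg_left (one_div_mul_exp_le_rpow hn hβ) hD)
      _ ≤ 4 * (B * L) + diam χ * (2 * L) + diam χ * B / r₀ * L :=
          le_add_of_nonneg_right (by positivity)
      _ = _ := by ring
  · calc _ ≤ ∫⁻ _ω, ENNReal.ofReal (diam χ) ∂(Measure.pi fun _ : Fin n =>
              volume.withDensity fun x => ENNReal.ofReal (f x)) :=
          lintegral_mono_ae ((ae_pi_forall_mem _ hae).mono fun ω hω =>
            ENNReal.ofReal_le_ofReal (hausdorffDist_range_le_of_forall_dist_le hdiam hω))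
      _ = ENNReal.ofReal (diam χ) := by simp
      _ ≤ _ := by
          refine ENNReal.ofReal_le_ofReal ?_
          calc diam χ ≤ diam χ * ((B * L) / r₀) :=
                le_mul_of_one_le_right hD ((one_le_div hr₀).2 h.le)
            _ ≤ diam χ * ((B * L) / r₀) + (4 * B + 2 * diam χ) * L :=
                le_add_of_nonneg_right (by positivity)
            _ = _ := by ring
end

section
/- Fix d ≥ 1 and α > 0. There exist a compact set χ ⊂ ℝ^d, positive constants C_a, C_b, δ_a, ε₀, f_max (defining the class 𝓕(α) of densities on χ satisfying assumptions [A] and [B] with these constants), a constant c > 0 and N ∈ ℕ such that for all n ≥ N and every estimator Ŝₙ (a Borel-measurable map from (ℝ^d)ⁿ to the space of nonempty compact subsets of ℝ^d with the Hausdorff metric), sup_{f ∈ 𝓕(α)} 𝔼_{f^{⊗n}}[ d_H( X_f, Ŝₙ(X₁,…,Xₙ) ) ] ≥ c · n^{−1/(d+α)}, where X_f is the support of the measure f·λ and X₁,…,Xₙ are i.i.d. with density f. -/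
open MeasureTheory Metric

theorem isClosed_msupp {M : Type*} [MetricSpace M] [MeasurableSpace M] (μ : Measure M) :
    IsClosed (msupp μ) := by
  refine isClosed_of_closure_subset fun x hx r hr => ?_
  obtain ⟨y, hy, hxy⟩ := Metric.mem_closure_iff.1 hx (r / 2) (half_pos hr)
  refine (hy (r / 2) (half_pos hr)).trans_le (measure_mono (ball_subset_ball' ?_))
  rw [dist_comm]
  linarith

theorem msupp_withDensity_subset {M : Type*} [MetricSpace M] [MeasurableSpace M]
    [OpensMeasurableSpace M] (μ : Measure M) {g : M → ℝ} {C : Set M} (hC : IsClosed C)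
    (hg : ∀ x ∉ C, g x = 0) :
    msupp (μ.withDensity fun x => ENNReal.ofReal (g x)) ⊆ C := by
  intro x hx
  by_contra hxC
  obtain ⟨r, hr, hrC⟩ := Metric.isOpen_iff.1 hC.isOpen_compl x hxC
  refine (hx r hr).ne' ?_
  rw [withDensity_apply _ measurableSet_ball]
  exact setLIntegral_eq_zero measurableSet_ball fun y hy => by simp [hg y (hrC hy)]

theorem subset_msupp_withDensity {M : Type*} [MetricSpace M] [MeasurableSpace M]
    (μ : Measure M) [μ.IsOpenPosMeasure] {g : M → ℝ} (hgm : Measurable g)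
    {U : Set M} (hU : IsOpen U) (hg : ∀ x ∈ U, 0 < g x) :
    U ⊆ msupp (μ.withDensity fun x => ENNReal.ofReal (g x)) := by
  intro x hx r hr
  refine pos_iff_ne_zero.2 fun h => ?_
  rw [withDensity_apply_eq_zero hgm.ennreal_ofReal] at h
  have hpos : 0 < μ (U ∩ ball x r) :=
    (hU.inter isOpen_ball).measure_pos μ ⟨x, hx, mem_ball_self hr⟩
  refine hpos.ne' (measure_mono_null (Set.inter_subset_inter_left _ fun y hy => ?_) h)
  simpa using hg y hy

/-- Le Cam's two-point bound when one measure dominates a multiple of the other on a set. -/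
theorem two_point_lower_bound {E : Type*} [MetricSpace E] [MeasurableSpace E]
    {μ₀ μ₁ : Measure E} [IsProbabilityMeasure μ₀] [SigmaFinite μ₁] {A : Set E} {t : ENNReal}
    (h : μ₁.restrict A = t • μ₀) (K₀ K₁ : TopologicalSpace.NonemptyCompacts E) {n : ℕ}
    {S : (Fin n → E) → TopologicalSpace.NonemptyCompacts E}
    (hS : @Measurable _ _ inferInstance (borel (TopologicalSpace.NonemptyCompacts E)) S) :
    t ^ n * ENNReal.ofReal (dist K₀ K₁) ≤
      t ^ n * ∫⁻ ω, ENNReal.ofReal (hausdorffDist (K₀ : Set E) (S ω)) ∂Measure.pi (fun _ => μ₀) +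
        ∫⁻ ω, ENNReal.ofReal (hausdorffDist (K₁ : Set E) (S ω)) ∂Measure.pi (fun _ => μ₁) := by
  have hpi : Measure.pi (fun _ : Fin n => μ₁.restrict A) =
      t ^ n • Measure.pi (fun _ : Fin n => μ₀) := by
    refine Measure.pi_eq fun s _ => ?_
    simp [h, Measure.pi_pi, Finset.prod_mul_distrib]
  have hle : t ^ n • Measure.pi (fun _ : Fin n => μ₀) ≤ Measure.pi (fun _ : Fin n => μ₁) := by
    rw [← hpi, ← Measure.restrict_pi_pi]
    exact Measure.restrict_le_self
  have hmeas : Measurable fun ω => ENNReal.ofReal (dist K₀ (S ω)) := by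
    let _ : MeasurableSpace (TopologicalSpace.NonemptyCompacts E) := borel _
    have : BorelSpace (TopologicalSpace.NonemptyCompacts E) := ⟨rfl⟩
    have hc : Continuous fun K : TopologicalSpace.NonemptyCompacts E =>
        ENNReal.ofReal (dist K₀ K) :=
      ENNReal.continuous_ofReal.comp (continuous_const.dist continuous_id)
    exact hc.measurable.comp hS
  simp only [← NonemptyCompacts.dist_eq]
  calc t ^ n * ENNReal.ofReal (dist K₀ K₁)
      = t ^ n * ∫⁻ _ : Fin n → E, ENNReal.ofReal (dist K₀ K₁) ∂Measure.pi (fun _ => μ₀) := by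
        simp
    _ ≤ t ^ n * ∫⁻ ω, (ENNReal.ofReal (dist K₀ (S ω)) + ENNReal.ofReal (dist K₁ (S ω)))
          ∂Measure.pi (fun _ => μ₀) := by
        gcongr with ω
        rw [← ENNReal.ofReal_add dist_nonneg dist_nonneg]
        exact ENNReal.ofReal_le_ofReal (dist_triangle_right _ _ _)
    _ = t ^ n * ∫⁻ ω, ENNReal.ofReal (dist K₀ (S ω)) ∂Measure.pi (fun _ => μ₀) +
          ∫⁻ ω, ENNReal.ofReal (dist K₁ (S ω)) ∂(t ^ n • Measure.pi (fun _ => μ₀)) := by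
        rw [lintegral_add_left hmeas, mul_add, lintegral_smul_measure, smul_eq_mul]
    _ ≤ _ := by
        gcongr

theorem ball_subset_innerSet {E : Type*} [NormedAddCommGroup E] [NormedSpace ℝ E] {G : Set E}
    {c : E} {r ε : ℝ} (hε : 0 < ε) (hεr : ε ≤ r) (hG : ball c r ⊆ G) :
    ball c r ⊆ innerSet ε G := by
  intro y hy
  have hr : 0 < r := hε.trans_le hεr
  have hy' : dist c y < r := by rw [dist_comm]; exact hy
  have hs0 : 0 ≤ (r - ε) / r := div_nonneg (by linarith) hr.le
  have hs1 : 1 - (r - ε) / r = ε / r := by field_simp; ring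
  refine Set.mem_iUnion₂.2 ⟨AffineMap.lineMap c y ((r - ε) / r), ?_, ?_⟩
  · refine (ball_subset_ball' ?_).trans hG
    rw [dist_lineMap_left, Real.norm_of_nonneg hs0]
    calc ε + (r - ε) / r * dist c y ≤ ε + (r - ε) / r * r := by gcongr
      _ = r := by field_simp; ring
  · rw [mem_ball, dist_comm, dist_lineMap_right, hs1, Real.norm_of_nonneg (by positivity)]
    calc ε / r * dist c y < ε / r * r := by gcongr
      _ = ε := by field_simp

theorem infDist_frontier_le_dist {E : Type*} [NormedAddCommGroup E] [NormedSpace ℝ E]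
    [FiniteDimensional ℝ E] {G : Set E} {x y : E} (hx : x ∈ G) (hy : y ∉ G) :
    infDist x (frontier G) ≤ dist x y := by
  obtain ⟨z, hz, hxz⟩ := exists_mem_frontier_infDist_compl_eq_dist hx
    ((Set.ne_univ_iff_exists_notMem G).2 ⟨y, hy⟩)
  calc infDist x (frontier G) ≤ dist x z := infDist_le_dist_of_mem hz
    _ = infDist x Gᶜ := hxz.symm
    _ ≤ dist x y := infDist_le_dist_of_mem hy

section TwoBalls

variable {d : ℕ}

/-- The reciprocal of the volume of the unit ball of `ℝ^d`. -/
noncomputable def unitBallDensity (d : ℕ) : ℝ :=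
  (volume.real (ball (0 : EuclideanSpace ℝ (Fin d)) 1))⁻¹

/-- The density that is constant on the unit ball and proportional to `h ^ α` on the ball of radius
`h` touching the unit ball from outside at the unit vector `e`. -/
noncomputable def twoBallDensity (α : ℝ) (e : EuclideanSpace ℝ (Fin d)) (h : ℝ) :
    EuclideanSpace ℝ (Fin d) → ℝ := fun x =>
  (ball 0 1).indicator (fun _ => unitBallDensity d * (1 - h ^ d * h ^ α)) x +
    (ball ((1 + h) • e) h).indicator (fun _ => unitBallDensity d * h ^ α) x

theorem unitBallDensity_pos : 0 < unitBallDensity d :=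
  inv_pos.2 (ENNReal.toReal_pos (measure_ball_pos _ _ one_pos).ne' measure_ball_lt_top.ne)

variable {α h : ℝ} {e : EuclideanSpace ℝ (Fin d)}

theorem measurable_twoBallDensity : Measurable (twoBallDensity α e h) :=
  (measurable_const.indicator measurableSet_ball).add
    (measurable_const.indicator measurableSet_ball)

theorem disjoint_tangent_balls (he : ‖e‖ = 1) (hh : 0 ≤ h) :
    Disjoint (ball (0 : EuclideanSpace ℝ (Fin d)) 1) (ball ((1 + h) • e) h) := by
  refine ball_disjoint_ball ?_
  rw [dist_zero_left, norm_smul, he, Real.norm_of_nonneg (by linarith), mul_one]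

theorem twoBallDensity_of_mem_unitBall (he : ‖e‖ = 1) (hh : 0 ≤ h)
    {x : EuclideanSpace ℝ (Fin d)} (hx : x ∈ ball 0 1) :
    twoBallDensity α e h x = unitBallDensity d * (1 - h ^ d * h ^ α) := by
  simp only [twoBallDensity, Set.indicator_of_mem hx,
    Set.indicator_of_notMem (Set.disjoint_left.1 (disjoint_tangent_balls he hh) hx), add_zero]

theorem twoBallDensity_of_mem_smallBall (he : ‖e‖ = 1) (hh : 0 ≤ h)
    {x : EuclideanSpace ℝ (Fin d)} (hx : x ∈ ball ((1 + h) • e) h) :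
    twoBallDensity α e h x = unitBallDensity d * h ^ α := by
  simp only [twoBallDensity, Set.indicator_of_mem hx,
    Set.indicator_of_notMem (Set.disjoint_right.1 (disjoint_tangent_balls he hh) hx), zero_add]

theorem twoBallDensity_of_notMem {x : EuclideanSpace ℝ (Fin d)}
    (hx : x ∉ ball 0 1 ∪ ball ((1 + h) • e) h) : twoBallDensity α e h x = 0 := by
  rw [Set.mem_union, not_or] at hx
  simp only [twoBallDensity, Set.indicator_of_notMem hx.1, Set.indicator_of_notMem hx.2, add_zero]

theorem twoBallDensity_pos_set (he : ‖e‖ = 1) (hh : 0 ≤ h) (hq : h ^ d * h ^ α ≤ 1 / 2) :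
    {x | 0 < twoBallDensity α e h x} = ball 0 1 ∪ ball ((1 + h) • e) h := by
  ext x
  refine ⟨fun hx => by_contra fun hx' => hx.ne' (twoBallDensity_of_notMem hx'), ?_⟩
  rintro (hx | hx)
  · rw [Set.mem_ofPred_eq, twoBallDensity_of_mem_unitBall he hh hx]
    exact mul_pos unitBallDensity_pos (by linarith)
  · rw [Set.mem_ofPred_eq, twoBallDensity_of_mem_smallBall he hh hx]
    have h0 : 0 < h := pos_of_mem_ball hx
    have := unitBallDensity_pos (d := d)
    positivity

theorem integral_twoBallDensity (hd : 1 ≤ d) (hh : 0 ≤ h) :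
    ∫ x, twoBallDensity α e h x = 1 := by
  have : Nontrivial (EuclideanSpace ℝ (Fin d)) := by
    have : Nonempty (Fin d) := ⟨⟨0, hd⟩⟩
    infer_instance
  have hV : volume.real (ball ((1 + h) • e) h) =
      h ^ d * volume.real (ball (0 : EuclideanSpace ℝ (Fin d)) 1) := by
    rw [Measure.real, Measure.addHaar_ball _ _ hh, ENNReal.toReal_mul,
      ENNReal.toReal_ofReal (by positivity), finrank_euclideanSpace_fin, Measure.real]
  have hk := (unitBallDensity_pos (d := d)).ne'
  have hk' : volume.real (ball (0 : EuclideanSpace ℝ (Fin d)) 1) = (unitBallDensity d)⁻¹ :=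
    (inv_inv _).symm
  have hint (c : EuclideanSpace ℝ (Fin d)) (r a : ℝ) :
      Integrable ((ball c r).indicator fun _ => a) :=
    (integrable_indicator_iff measurableSet_ball).2
      (integrableOn_const measure_ball_lt_top.ne)
  unfold twoBallDensity
  rw [integral_add (hint _ _ _) (hint _ _ _), integral_indicator_const _ measurableSet_ball,
    integral_indicator_const _ measurableSet_ball, hV, hk', smul_eq_mul, smul_eq_mul]
  field_simp
  ring

theorem twoBallDensity_nonneg (hh : 0 ≤ h) (hq : h ^ d * h ^ α ≤ 1 / 2)
    (x : EuclideanSpace ℝ (Fin d)) : 0 ≤ twoBallDensity α e h x := by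
  have := unitBallDensity_pos (d := d)
  have h1 : 0 ≤ 1 - h ^ d * h ^ α := by linarith
  refine add_nonneg (Set.indicator_nonneg (fun _ _ => ?_) _)
    (Set.indicator_nonneg (fun _ _ => ?_) _) <;> positivity

theorem dist_le_of_mem_closedBall_tangent (he : ‖e‖ = 1) {x : EuclideanSpace ℝ (Fin d)}
    (hx : x ∈ closedBall ((1 + h) • e) h) : dist x e ≤ 2 * h := by
  have hh : 0 ≤ h := nonempty_closedBall.1 ⟨x, hx⟩
  have : dist ((1 + h) • e) e = h := by
    rw [dist_eq_norm, show (1 + h) • e - e = h • e by module, norm_smul, he,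
      Real.norm_of_nonneg hh, mul_one]
  linarith [dist_triangle x ((1 + h) • e) e, mem_closedBall.1 hx]

theorem twoBall_subset_closedBall (he : ‖e‖ = 1) (hh1 : h ≤ 1) :
    ball 0 1 ∪ ball ((1 + h) • e) h ⊆ closedBall (0 : EuclideanSpace ℝ (Fin d)) 3 := by
  rintro x (hx | hx)
  · exact ball_subset_closedBall.trans (closedBall_subset_closedBall (by norm_num)) hx
  · have := dist_le_of_mem_closedBall_tangent he (ball_subset_closedBall hx)
    rw [mem_closedBall]
    linarith [dist_triangle x e 0, dist_zero_right e]

theorem infDist_frontier_twoBall_le (he : ‖e‖ = 1) (hh : 0 ≤ h)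
    {x : EuclideanSpace ℝ (Fin d)} (hx : x ∈ ball ((1 + h) • e) h) :
    infDist x (frontier (ball 0 1 ∪ ball ((1 + h) • e) h)) ≤ 2 * h := by
  have hy : dist ((1 + 2 * h) • e) ((1 + h) • e) = h := by
    rw [dist_eq_norm, show (1 + 2 * h) • e - (1 + h) • e = h • e by module, norm_smul, he,
      Real.norm_of_nonneg hh, mul_one]
  refine (infDist_frontier_le_dist (y := (1 + 2 * h) • e) (Or.inr hx) ?_).trans ?_
  · rintro (h' | h')
    · rw [mem_ball, dist_zero_right, norm_smul, he, Real.norm_of_nonneg (by linarith)] at h'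
      linarith
    · rw [mem_ball, hy] at h'
      exact lt_irrefl _ h'
  · have := mem_ball.1 hx
    rw [dist_comm] at hy
    linarith [dist_triangle x ((1 + h) • e) ((1 + 2 * h) • e)]

theorem infDist_innerSet_twoBall_le (he : ‖e‖ = 1) {ε : ℝ} (hε : 0 < ε)
    (hε1 : ε ≤ 1) {x : EuclideanSpace ℝ (Fin d)}
    (hx : x ∈ closure (ball 0 1 ∪ ball ((1 + h) • e) h)) :
    infDist x (innerSet ε (ball 0 1 ∪ ball ((1 + h) • e) h)) ≤ 2 * ε := by
  have hone := ball_subset_innerSet hε hε1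
    (Set.subset_union_left (s := ball 0 1) (t := ball ((1 + h) • e) h))
  have hne : (ball (0 : EuclideanSpace ℝ (Fin d)) 1).Nonempty := nonempty_ball.2 one_pos
  rcases le_or_gt ε h with hεh | hεh
  · have hsub := Set.union_subset hone (ball_subset_innerSet hε hεh Set.subset_union_right)
    rw [(mem_closure_iff_infDist_zero (hne.mono hone)).1 (closure_mono hsub hx)]
    positivity
  · refine (infDist_le_infDist_of_subset hone hne).trans ?_
    rw [closure_union] at hx
    rcases hx with hx | hx
    · rw [(mem_closure_iff_infDist_zero hne).1 hx]
      positivity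
    · rw [← infDist_closure, closure_ball _ one_ne_zero]
      have hd := dist_le_of_mem_closedBall_tangent he (closure_ball_subset_closedBall hx)
      have := infDist_le_dist_of_mem (x := x) (y := e)
        (s := closedBall (0 : EuclideanSpace ℝ (Fin d)) 1) (by simp [he])
      linarith

theorem twoBallDensity_mem_class (hd : 1 ≤ d) (hα : 0 < α) (he : ‖e‖ = 1) (hh : 0 ≤ h)
    (hh1 : h ≤ 1) (hq : h ^ d * h ^ α ≤ 1 / 2) :
    FclassAB (closedBall 0 3) α (unitBallDensity d / 2 ^ α) 2 (unitBallDensity d / 4) 1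
      (unitBallDensity d) (twoBallDensity α e h) := by
  have hk := unitBallDensity_pos (d := d)
  refine ⟨measurable_twoBallDensity, twoBallDensity_nonneg hh hq,
    integral_twoBallDensity hd hh, fun x hx => ?_, fun x => ?_, ?_, ?_⟩
  · exact twoBallDensity_of_notMem fun hx' => hx (twoBall_subset_closedBall he hh1 hx')
  · by_cases hx : x ∈ ball 0 1 ∪ ball ((1 + h) • e) h
    · rcases hx with hx | hx
      · rw [twoBallDensity_of_mem_unitBall he hh hx]
        refine mul_le_of_le_one_right hk.le ?_
        have : 0 ≤ h ^ d * h ^ α := by positivity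
        linarith
      · rw [twoBallDensity_of_mem_smallBall he hh hx]
        exact mul_le_of_le_one_right hk.le (Real.rpow_le_one hh hh1 hα.le)
    · rw [twoBallDensity_of_notMem hx]
      exact hk.le
  · rw [twoBallDensity_pos_set he hh hq]
    rintro x (hx | hx) hle
    · rw [twoBallDensity_of_mem_unitBall he hh hx] at hle
      nlinarith
    · rw [twoBallDensity_of_mem_smallBall he hh hx]
      calc unitBallDensity d / 2 ^ α *
            infDist x (frontier (ball 0 1 ∪ ball ((1 + h) • e) h)) ^ α
          ≤ unitBallDensity d / 2 ^ α * (2 * h) ^ α := by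
            gcongr
            exacts [infDist_nonneg, infDist_frontier_twoBall_le he hh hx]
        _ = unitBallDensity d * h ^ α := by
            rw [Real.mul_rpow zero_le_two hh]
            have : (2 : ℝ) ^ α ≠ 0 := by positivity
            field_simp
  · intro ε hε hε1
    rw [twoBallDensity_pos_set he hh hq]
    refine ⟨(nonempty_ball.2 one_pos).mono (ball_subset_innerSet hε hε1 Set.subset_union_left),
      fun x hx => infDist_innerSet_twoBall_le he hε hε1 (frontier_subset_closure hx)⟩

theorem restrict_withDensity_twoBallDensity (hα : 0 < α) (he : ‖e‖ = 1)
    (hh : 0 ≤ h) (hq : h ^ d * h ^ α ≤ 1 / 2) :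
    (volume.withDensity fun x => ENNReal.ofReal (twoBallDensity α e h x)).restrict (ball 0 1) =
      ENNReal.ofReal (1 - h ^ d * h ^ α) •
        volume.withDensity fun x => ENNReal.ofReal (twoBallDensity α e 0 x) := by
  rw [restrict_withDensity measurableSet_ball, ← withDensity_indicator measurableSet_ball,
    ← withDensity_smul _ measurable_twoBallDensity.ennreal_ofReal]
  congr 1
  ext x
  rw [Pi.smul_apply, smul_eq_mul, ← ENNReal.ofReal_mul (by linarith)]
  by_cases hx : x ∈ ball 0 1
  · rw [Set.indicator_of_mem hx, twoBallDensity_of_mem_unitBall he hh hx,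
      twoBallDensity_of_mem_unitBall he le_rfl hx]
    simp [hα.ne', mul_comm]
  · rw [Set.indicator_of_notMem hx, twoBallDensity_of_notMem (h := 0) (by simpa using hx)]
    simp

theorem isProbabilityMeasure_twoBallDensity (hd : 1 ≤ d) (hh : 0 ≤ h)
    (hq : h ^ d * h ^ α ≤ 1 / 2) : IsProbabilityMeasure
      (volume.withDensity fun x => ENNReal.ofReal (twoBallDensity α e h x)) := by
  refine ⟨?_⟩
  have hone := integral_twoBallDensity (α := α) (e := e) hd hh
  rw [withDensity_apply _ MeasurableSet.univ, Measure.restrict_univ,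
    ← ofReal_integral_eq_lintegral_ofReal
      (not_imp_comm.1 integral_undef (by rw [hone]; exact one_ne_zero))
      (Filter.Eventually.of_forall (twoBallDensity_nonneg hh hq)), hone, ENNReal.ofReal_one]

theorem exists_nonemptyCompacts_eq_msupp_twoBallDensity (he : ‖e‖ = 1) (hh : 0 ≤ h)
    (hq : h ^ d * h ^ α ≤ 1 / 2) :
    ∃ K : TopologicalSpace.NonemptyCompacts (EuclideanSpace ℝ (Fin d)),
      (K : Set (EuclideanSpace ℝ (Fin d))) =
          msupp (volume.withDensity fun x => ENNReal.ofReal (twoBallDensity α e h x)) ∧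
        ball 0 1 ∪ ball ((1 + h) • e) h ⊆ (K : Set (EuclideanSpace ℝ (Fin d))) ∧
        (K : Set (EuclideanSpace ℝ (Fin d))) ⊆ closedBall 0 1 ∪ closedBall ((1 + h) • e) h := by
  have hsub := subset_msupp_withDensity volume (measurable_twoBallDensity (α := α) (e := e) (h := h))
    (isOpen_ball.union isOpen_ball) fun x hx => (twoBallDensity_pos_set he hh hq).ge hx
  have hsup := msupp_withDensity_subset volume (g := twoBallDensity α e h)
    (isClosed_closedBall.union isClosed_closedBall) fun x hx => twoBallDensity_of_notMem fun hx' =>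
      hx (Set.union_subset_union ball_subset_closedBall ball_subset_closedBall hx')
  exact ⟨⟨⟨_, ((isCompact_closedBall _ _).union (isCompact_closedBall _ _)).of_isClosed_subset
    (isClosed_msupp _) hsup⟩, (Set.Nonempty.inl (nonempty_ball.2 one_pos)).mono hsub⟩,
    rfl, hsub, hsup⟩

theorem le_dist_of_subset_closedBall (he : ‖e‖ = 1) (hh : 0 < h)
    {K₀ K₁ : TopologicalSpace.NonemptyCompacts (EuclideanSpace ℝ (Fin d))}
    (h₀ : (K₀ : Set (EuclideanSpace ℝ (Fin d))) ⊆ closedBall 0 1)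
    (h₁ : (1 + h) • e ∈ K₁) : h ≤ dist K₀ K₁ := by
  rw [dist_comm, NonemptyCompacts.dist_eq]
  refine le_trans ?_ (infDist_le_hausdorffDist_of_mem h₁ (edist_ne_top K₁ K₀))
  refine (le_infDist K₀.nonempty).2 fun y hy => ?_
  have hy1 : dist y 0 ≤ 1 := h₀ hy
  have hp : dist ((1 + h) • e) 0 = 1 + h := by
    rw [dist_zero_right, norm_smul, he, Real.norm_of_nonneg (by linarith), mul_one]
  linarith [dist_triangle ((1 + h) • e) y 0]

end TwoBalls

/-- Fix `d ≥ 1` and `α > 0`. There exist a compact `χ ⊂ ℝ^d`, positive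
constants `C_a, C_b, δ_a, ε₀, f_max` (defining the class `𝓕(α)`), a constant `c > 0`
and `N ∈ ℕ` such that for all `n ≥ N` and every Borel-measurable estimator
`S : (ℝ^d)ⁿ → {nonempty compact subsets of ℝ^d}` (with the Hausdorff metric on the
codomain), `sup_{f ∈ 𝓕(α)} 𝔼_{f^⊗n}[d_H(X_f, S(X₁,…,Xₙ))] ≥ c n^{-1/(d+α)}`, where
`X_f` is the support of `f·λ`. -/
theorem stmt_13 {d : ℕ} (hd : 1 ≤ d) (α : ℝ) (hα : 0 < α) :
    ∃ (χ : Set (EuclideanSpace ℝ (Fin d))) (Ca Cb δa ε₀ fmax c : ℝ) (N : ℕ),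
      IsCompact χ ∧ 0 < Ca ∧ 0 < Cb ∧ 0 < δa ∧ 0 < ε₀ ∧ 0 < fmax ∧ 0 < c ∧
      ∀ n : ℕ, N ≤ n →
        ∀ S : (Fin n → EuclideanSpace ℝ (Fin d)) →
            TopologicalSpace.NonemptyCompacts (EuclideanSpace ℝ (Fin d)),
          @Measurable _ _ inferInstance
            (borel (TopologicalSpace.NonemptyCompacts (EuclideanSpace ℝ (Fin d)))) S →
          ENNReal.ofReal (c * (n : ℝ) ^ (-(1 : ℝ) / (d + α))) ≤
            ⨆ f : {g : EuclideanSpace ℝ (Fin d) → ℝ // FclassAB χ α Ca Cb δa ε₀ fmax g},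
              ∫⁻ ω, ENNReal.ofReal
                  (hausdorffDist
                    (msupp (volume.withDensity fun x => ENNReal.ofReal (f.1 x)))
                    ((S ω : Set (EuclideanSpace ℝ (Fin d)))))
                ∂(Measure.pi fun _ : Fin n =>
                    volume.withDensity fun x => ENNReal.ofReal (f.1 x)) := by
  have hk := unitBallDensity_pos (d := d)
  have hdα : 0 < (d : ℝ) + α := by positivity
  obtain ⟨e, he⟩ : ∃ e : EuclideanSpace ℝ (Fin d), ‖e‖ = 1 :=
    ⟨EuclideanSpace.single ⟨0, hd⟩ 1, by simp⟩
  refine ⟨closedBall 0 3, unitBallDensity d / 2 ^ α, 2, unitBallDensity d / 4, 1,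
    unitBallDensity d, 1 / 4 * (2 : ℝ) ^ (-(1 : ℝ) / (d + α)), 1, isCompact_closedBall _ _,
    by positivity, two_pos, by positivity, one_pos, hk, by positivity, ?_⟩
  intro n hn S hS
  have hn1 : (1 : ℝ) ≤ n := by exact_mod_cast hn
  set h : ℝ := (2 * (n : ℝ)) ^ (-(1 : ℝ) / (d + α)) with h_def
  have hh : 0 < h := by positivity
  have hh1 : h ≤ 1 := Real.rpow_le_one_of_one_le_of_nonpos (by linarith)
    (div_nonpos_of_nonpos_of_nonneg (by norm_num) hdα.le)
  have hqn : h ^ d * h ^ α = 1 / (2 * n) := by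
    rw [← Real.rpow_natCast h d, ← Real.rpow_add hh, h_def, ← Real.rpow_mul (by positivity),
      div_mul_cancel₀ _ hdα.ne', Real.rpow_neg_one, one_div]
  have hq : h ^ d * h ^ α ≤ 1 / 2 := by
    rw [hqn]
    exact one_div_le_one_div_of_le two_pos (by linarith)
  have hq0 : (0 : ℝ) ^ d * 0 ^ α ≤ 1 / 2 := by simp [Real.zero_rpow hα.ne']
  obtain ⟨K₀, hK₀, -, hK₀'⟩ :=
    exists_nonemptyCompacts_eq_msupp_twoBallDensity he le_rfl hq0
  obtain ⟨K₁, hK₁, hK₁', -⟩ :=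
    exists_nonemptyCompacts_eq_msupp_twoBallDensity he hh.le hq
  have hdist : h ≤ dist K₀ K₁ := by
    refine le_dist_of_subset_closedBall he hh (hK₀'.trans (Set.union_subset subset_rfl ?_))
      (hK₁' (Or.inr (mem_ball_self hh)))
    simp [he]
  have := isProbabilityMeasure_twoBallDensity (e := e) hd le_rfl hq0
  have := isProbabilityMeasure_twoBallDensity (e := e) hd hh.le hq
  have key := two_point_lower_bound
    (restrict_withDensity_twoBallDensity hα he hh.le hq) K₀ K₁ hS
  rw [hK₀, hK₁] at key
  have hle₀ := le_iSup (fun f : {g : EuclideanSpace ℝ (Fin d) → ℝ //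
      FclassAB (closedBall 0 3) α (unitBallDensity d / 2 ^ α) 2 (unitBallDensity d / 4) 1
        (unitBallDensity d) g} => ∫⁻ ω, ENNReal.ofReal
          (hausdorffDist (msupp (volume.withDensity fun x => ENNReal.ofReal (f.1 x)))
            (S ω : Set (EuclideanSpace ℝ (Fin d))))
        ∂(Measure.pi fun _ : Fin n => volume.withDensity fun x => ENNReal.ofReal (f.1 x)))
  have hle₁ := hle₀
    ⟨_, twoBallDensity_mem_class hd hα he hh.le hh1 hq⟩
  replace hle₀ := hle₀
    ⟨_, twoBallDensity_mem_class hd hα he le_rfl zero_le_one hq0⟩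
  set R := ⨆ f : {g : EuclideanSpace ℝ (Fin d) → ℝ //
      FclassAB (closedBall 0 3) α (unitBallDensity d / 2 ^ α) 2 (unitBallDensity d / 4) 1
        (unitBallDensity d) g}, ∫⁻ ω, ENNReal.ofReal
          (hausdorffDist (msupp (volume.withDensity fun x => ENNReal.ofReal (f.1 x)))
            (S ω : Set (EuclideanSpace ℝ (Fin d))))
        ∂(Measure.pi fun _ : Fin n => volume.withDensity fun x => ENNReal.ofReal (f.1 x))
  have hbern : 1 / 2 ≤ (1 - h ^ d * h ^ α) ^ n := by
    have := one_add_mul_le_pow (a := -(h ^ d * h ^ α)) (by linarith) n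
    rw [← sub_eq_add_neg, hqn] at this
    rw [hqn]
    refine le_trans (le_of_eq ?_) this
    field_simp
    norm_num
  have ht1 : ENNReal.ofReal (1 - h ^ d * h ^ α) ^ n ≤ 1 :=
    pow_le_one₀ zero_le (ENNReal.ofReal_le_one.2 (sub_le_self _ (by positivity)))
  have hc : 1 / 4 * (2 : ℝ) ^ (-(1 : ℝ) / (d + α)) * (n : ℝ) ^ (-(1 : ℝ) / (d + α)) =
      1 / 4 * h := by
    rw [h_def, Real.mul_rpow zero_le_two (by linarith), mul_assoc]
  rw [hc]
  have htwo : 2 * ENNReal.ofReal (1 / 4 * h) ≤ 2 * R := by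
    calc 2 * ENNReal.ofReal (1 / 4 * h)
        = ENNReal.ofReal (1 / 2 * h) := by
          rw [← ENNReal.ofReal_ofNat 2, ← ENNReal.ofReal_mul zero_le_two]
          congr 1
          ring
      _ ≤ ENNReal.ofReal ((1 - h ^ d * h ^ α) ^ n * dist K₀ K₁) := by
          gcongr
      _ = ENNReal.ofReal (1 - h ^ d * h ^ α) ^ n * ENNReal.ofReal (dist K₀ K₁) := by
          rw [ENNReal.ofReal_mul (le_trans (by norm_num) hbern),
            ENNReal.ofReal_pow (by linarith)]
      _ ≤ 1 * R + R := key.trans (by gcongr)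
      _ = 2 * R := by rw [one_mul, two_mul]
  exact (ENNReal.mul_le_mul_iff_right two_ne_zero ENNReal.ofNat_ne_top).1 htwo
end
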